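/- arXiv:1607.05561 — 9 statements merged into one kernel-verified Lean document; each statement's English description precedes it below -/
import Mathlib

section
/- In the deterministic sandpile setup, the toppling operators pairwise commute: for all sites v, w ∈ Fin N, T_v ∘ T_w = T_w ∘ T_v as maps on (Fin N → ℤ) × (Fin N → ℕ). -/
/-- `ν` is a possible toppling vector for site `v`: `v` loses grains, every other
site gains a nonnegative amount, and the total number of grains does not increase. -/
def IsTopplingVector {N : ℕ} (v : Fin N) (ν : Fin N → ℤ) : Prop :=
  ν v < 0 ∧ (∀ w, w ≠ v → 0 ≤ ν w) ∧ (∑ i, ν i) ≤ 0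

/-- A deck assigns to each site an infinite sequence of toppling vectors (cards). -/
def IsDeck {N : ℕ} (D : Fin N → ℕ → Fin N → ℤ) : Prop :=
  ∀ v i, IsTopplingVector v (D v i)

/-- The toppling operator `T_v` on configurations with counters:
apply the card `D v (c v)` and increment the counter at `v`. -/
def topple {N : ℕ} (D : Fin N → ℕ → Fin N → ℤ) (v : Fin N)
    (p : (Fin N → ℤ) × (Fin N → ℕ)) : (Fin N → ℤ) × (Fin N → ℕ) :=
  (p.1 + D v (p.2 v), p.2 + fun w => if w = v then 1 else 0)

/-- Apply the topplings of the sequence `s = (v_1, …, v_n)` in order,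
i.e. `T_{v_n} ∘ ⋯ ∘ T_{v_1}`. -/
def toppleList {N : ℕ} (D : Fin N → ℕ → Fin N → ℤ) (s : List (Fin N))
    (p : (Fin N → ℤ) × (Fin N → ℕ)) : (Fin N → ℤ) × (Fin N → ℕ) :=
  s.foldl (fun q v => topple D v q) p

/-- Site `v` is unstable in `η` (w.r.t. thresholds `M`) if `η v > M v`. -/
def Unstable {N : ℕ} (M : Fin N → ℤ) (η : Fin N → ℤ) (v : Fin N) : Prop :=
  M v < η v

/-- A configuration is stable if no site is unstable. -/
def Stable {N : ℕ} (M : Fin N → ℤ) (η : Fin N → ℤ) : Prop :=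
  ∀ v, η v ≤ M v

/-- `(v_1, …, v_n)` is legal for `(η, c)` if each `v_i` is unstable in the
configuration part of `(T_{v_{i-1}} ∘ ⋯ ∘ T_{v_1})(η, c)`. -/
def Legal {N : ℕ} (D : Fin N → ℕ → Fin N → ℤ) (M : Fin N → ℤ)
    (s : List (Fin N)) (p : (Fin N → ℤ) × (Fin N → ℕ)) : Prop :=
  ∀ i : Fin s.length, Unstable M (toppleList D (s.take i) p).1 (s.get i)

/-- A sequence is stabilizing for `(η, c)` if it is legal and the resulting
configuration is stable. -/
def Stabilizing {N : ℕ} (D : Fin N → ℕ → Fin N → ℤ) (M : Fin N → ℤ)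
    (s : List (Fin N)) (p : (Fin N → ℤ) × (Fin N → ℕ)) : Prop :=
  Legal D M s p ∧ Stable M (toppleList D s p).1

/-- The toppling operators pairwise commute. -/
theorem toppling_operators_commute {N : ℕ} (D : Fin N → ℕ → Fin N → ℤ)
    (hD : IsDeck D) (v w : Fin N) :
    topple D v ∘ topple D w = topple D w ∘ topple D v := by
  obtain rfl | h := eq_or_ne v w
  · rfl
  · funext p
    refine Prod.ext ?_ ?_
    · simp only [Function.comp_apply, topple, Pi.add_apply, if_neg h, if_neg h.symm, add_zero]
      exact add_right_comm _ _ _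
    · exact add_right_comm _ _ _
end

section
/- Let (η, c) be a configuration with counters that admits a stabilizing sequence (v_1, …, v_n), and let (ξ, d) = (T_{v_n} ∘ ⋯ ∘ T_{v_1})(η, c). Then the final counters d are maximal: for any legal sequence (w_1, …, w_p) for (η, c), writing (ξ', d') = (T_{w_p} ∘ ⋯ ∘ T_{w_1})(η, c), one has d' v ≤ d v for all v ∈ Fin N. -/
/-- Toppling preserves the configuration minus the total of all cards used so far. -/
lemma topple_fst_sub_sum {N : ℕ} (D : Fin N → ℕ → Fin N → ℤ) (v : Fin N)
    (p : (Fin N → ℤ) × (Fin N → ℕ)) :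
    (topple D v p).1 - ∑ w, ∑ i ∈ Finset.range ((topple D v p).2 w), D w i =
      p.1 - ∑ w, ∑ i ∈ Finset.range (p.2 w), D w i := by
  have h : ∀ w, ∑ i ∈ Finset.range ((topple D v p).2 w), D w i =
      (∑ i ∈ Finset.range (p.2 w), D w i) + if w = v then D v (p.2 v) else 0 := by
    intro w
    by_cases hw : w = v
    · subst hw
      simp [topple, Finset.sum_range_succ]
    · simp [topple, hw]
  simp only [h, Finset.sum_add_distrib, Finset.sum_ite_eq', Finset.mem_univ, if_true]
  simp [topple]

lemma toppleList_append_singleton {N : ℕ} (D : Fin N → ℕ → Fin N → ℤ) (s : List (Fin N))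
    (v : Fin N) (p : (Fin N → ℤ) × (Fin N → ℕ)) :
    toppleList D (s ++ [v]) p = topple D v (toppleList D s p) := by
  simp [toppleList]

lemma toppleList_fst_sub_sum {N : ℕ} (D : Fin N → ℕ → Fin N → ℤ) (s : List (Fin N))
    (p : (Fin N → ℤ) × (Fin N → ℕ)) :
    (toppleList D s p).1 - ∑ w, ∑ i ∈ Finset.range ((toppleList D s p).2 w), D w i =
      p.1 - ∑ w, ∑ i ∈ Finset.range (p.2 w), D w i := by
  induction s using List.reverseRecOn with
  | nil => rfl
  | append_singleton s v ih =>
    rw [toppleList_append_singleton, topple_fst_sub_sum, ih]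

lemma le_toppleList_snd {N : ℕ} (D : Fin N → ℕ → Fin N → ℤ) (s : List (Fin N))
    (p : (Fin N → ℤ) × (Fin N → ℕ)) (v : Fin N) : p.2 v ≤ (toppleList D s p).2 v := by
  induction s using List.reverseRecOn with
  | nil => exact le_rfl
  | append_singleton s u ih =>
    rw [toppleList_append_singleton]
    exact ih.trans (Nat.le_add_right _ _)

lemma Legal.of_append_singleton {N : ℕ} {D : Fin N → ℕ → Fin N → ℤ} {M : Fin N → ℤ}
    {s : List (Fin N)} {v : Fin N} {p : (Fin N → ℤ) × (Fin N → ℕ)}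
    (h : Legal D M (s ++ [v]) p) :
    Legal D M s p ∧ Unstable M (toppleList D s p).1 v := by
  refine ⟨fun i => ?_, ?_⟩
  · have hi := h ⟨i, by simp⟩
    simpa [List.take_append_of_le_length i.2.le] using hi
  · simpa using h ⟨s.length, by simp⟩

/-- If two toppling sequences from the same start use the same number of cards at `v`, and the
second uses at least as many cards as the first at every site, then it leaves at least as many
grains at `v`. -/
lemma toppleList_fst_le {N : ℕ} {D : Fin N → ℕ → Fin N → ℤ} (hD : IsDeck D)
    {s t : List (Fin N)} {p : (Fin N → ℤ) × (Fin N → ℕ)} {v : Fin N}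
    (hle : ∀ w, (toppleList D t p).2 w ≤ (toppleList D s p).2 w)
    (hv : (toppleList D t p).2 v = (toppleList D s p).2 v) :
    (toppleList D t p).1 v ≤ (toppleList D s p).1 v := by
  have h := congrFun ((toppleList_fst_sub_sum D t p).trans
    (toppleList_fst_sub_sum D s p).symm) v
  simp only [Pi.sub_apply, Finset.sum_apply] at h
  have hsum : ∑ w, ∑ i ∈ Finset.range ((toppleList D t p).2 w), D w i v ≤
      ∑ w, ∑ i ∈ Finset.range ((toppleList D s p).2 w), D w i v := by
    refine Finset.sum_le_sum fun w _ => ?_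
    by_cases hw : w = v
    · rw [hw, hv]
    · exact Finset.sum_le_sum_of_subset_of_nonneg (Finset.range_subset_range.2 (hle w))
        fun i _ _ => (hD w i).2.1 v (Ne.symm hw)
  linarith

/-- If `(η, c)` admits a stabilizing sequence `s` with result `(ξ, d)`, then the
counters `d` are maximal among results of legal sequences. -/
theorem counters_maximal {N : ℕ} (D : Fin N → ℕ → Fin N → ℤ) (hD : IsDeck D)
    (M : Fin N → ℤ) (η : Fin N → ℤ) (c : Fin N → ℕ)
    (s : List (Fin N)) (hs : Stabilizing D M s (η, c))
    (t : List (Fin N)) (ht : Legal D M t (η, c)) :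
    ∀ v : Fin N, (toppleList D t (η, c)).2 v ≤ (toppleList D s (η, c)).2 v := by
  induction t using List.reverseRecOn with
  | nil => exact le_toppleList_snd D s (η, c)
  | append_singleton t u ih =>
    obtain ⟨ht, hu⟩ := ht.of_append_singleton
    have hle := ih ht
    intro v
    rw [toppleList_append_singleton]
    by_cases hv : v = u
    · subst hv
      have hne : (toppleList D t (η, c)).2 v ≠ (toppleList D s (η, c)).2 v := fun heq =>
        (hu.trans_le (toppleList_fst_le hD hle heq)).not_ge (hs.2 v)
      simpa [topple] using Nat.succ_le_of_lt (lt_of_le_of_ne (hle v) hne)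
    · simpa [topple, hv] using hle v
end

section
/- Stabilization is well defined: if (v_1, …, v_n) and (w_1, …, w_p) are both stabilizing sequences for the same configuration with counters (η, c), then they produce the same result, i.e. (T_{v_n} ∘ ⋯ ∘ T_{v_1})(η, c) = (T_{w_p} ∘ ⋯ ∘ T_{w_1})(η, c), and in particular n = p. -/
theorem legal_cons_iff {N : ℕ} {D : Fin N → ℕ → Fin N → ℤ} {M : Fin N → ℤ} {v : Fin N}
    {s : List (Fin N)} {p : (Fin N → ℤ) × (Fin N → ℕ)} :
    Legal D M (v :: s) p ↔ Unstable M p.1 v ∧ Legal D M s (topple D v p) :=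
  Fin.forall_fin_succ

theorem stabilizing_cons_iff {N : ℕ} {D : Fin N → ℕ → Fin N → ℤ} {M : Fin N → ℤ} {v : Fin N}
    {s : List (Fin N)} {p : (Fin N → ℤ) × (Fin N → ℕ)} :
    Stabilizing D M (v :: s) p ↔ Unstable M p.1 v ∧ Stabilizing D M s (topple D v p) := by
  simp only [Stabilizing, legal_cons_iff, and_assoc, toppleList, List.foldl_cons]

theorem topple_comm {N : ℕ} (D : Fin N → ℕ → Fin N → ℤ) {v w : Fin N} (h : v ≠ w)
    (p : (Fin N → ℤ) × (Fin N → ℕ)) :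
    topple D v (topple D w p) = topple D w (topple D v p) := by
  simp [topple, h, h.symm, add_right_comm]

theorem Unstable.topple {N : ℕ} {D : Fin N → ℕ → Fin N → ℤ} (hD : IsDeck D) {M : Fin N → ℤ}
    {v w : Fin N} (h : v ≠ w) {p : (Fin N → ℤ) × (Fin N → ℕ)} (hv : Unstable M p.1 v) :
    Unstable M (topple D w p).1 v :=
  lt_add_of_lt_of_nonneg hv ((hD w (p.2 w)).2.1 v h)

/-- An unstable site must occur in every stabilizing sequence, and its first occurrence
can be moved to the front. -/
theorem Stabilizing.exists_cons {N : ℕ} {D : Fin N → ℕ → Fin N → ℤ} (hD : IsDeck D)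
    {M : Fin N → ℤ} {v : Fin N} {t : List (Fin N)} {p : (Fin N → ℤ) × (Fin N → ℕ)}
    (ht : Stabilizing D M t p) (hv : Unstable M p.1 v) :
    ∃ t', Stabilizing D M t' (topple D v p) ∧
      toppleList D t' (topple D v p) = toppleList D t p ∧ t.length = t'.length + 1 := by
  induction t generalizing p with
  | nil => exact absurd hv (ht.2 v).not_gt
  | cons w t ih =>
    obtain ⟨hw, ht⟩ := stabilizing_cons_iff.1 ht
    obtain rfl | hvw := eq_or_ne v w
    · exact ⟨t, ht, rfl, rfl⟩
    · obtain ⟨t', ht', heq, hlen⟩ := ih ht (hv.topple hD hvw)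
      rw [topple_comm D hvw] at ht' heq
      exact ⟨w :: t', stabilizing_cons_iff.2 ⟨hw.topple hD hvw.symm, ht'⟩, heq,
        congrArg (· + 1) hlen⟩

theorem Stabilizing.unique {N : ℕ} {D : Fin N → ℕ → Fin N → ℤ} (hD : IsDeck D)
    {M : Fin N → ℤ} {s t : List (Fin N)} {p : (Fin N → ℤ) × (Fin N → ℕ)}
    (hs : Stabilizing D M s p) (ht : Stabilizing D M t p) :
    toppleList D s p = toppleList D t p ∧ s.length = t.length := by
  induction s generalizing p t with
  | nil =>
    cases t with
    | nil => exact ⟨rfl, rfl⟩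
    | cons w t => exact absurd (stabilizing_cons_iff.1 ht).1 (hs.2 w).not_gt
  | cons v s ih =>
    obtain ⟨hv, hs⟩ := stabilizing_cons_iff.1 hs
    obtain ⟨t', ht', heq, hlen⟩ := ht.exists_cons hD hv
    obtain ⟨h, hl⟩ := ih hs ht'
    exact ⟨h.trans heq, (congrArg (· + 1) hl).trans hlen.symm⟩

/-- Stabilization is well defined: any two stabilizing sequences for the same
configuration with counters produce the same result, and have the same length. -/
theorem stabilization_well_defined {N : ℕ} (D : Fin N → ℕ → Fin N → ℤ) (hD : IsDeck D)
    (M : Fin N → ℤ) (η : Fin N → ℤ) (c : Fin N → ℕ)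
    (s t : List (Fin N))
    (hs : Stabilizing D M s (η, c)) (ht : Stabilizing D M t (η, c)) :
    toppleList D s (η, c) = toppleList D t (η, c) ∧ s.length = t.length := by
  exact hs.unique hD ht
end

section
/- If a configuration with counters (η, c) admits a stabilizing sequence of length n, then every legal sequence for (η, c) has length at most n. -/
lemma toppleList_snd_apply {N : ℕ} (D : Fin N → ℕ → Fin N → ℤ) (s : List (Fin N))
    (p : (Fin N → ℤ) × (Fin N → ℕ)) (w : Fin N) :
    (toppleList D s p).2 w = p.2 w + s.count w := by
  induction s using List.reverseRecOn with
  | nil => simp [toppleList]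
  | append_singleton s v ih =>
    rw [toppleList_append_singleton]
    simp only [topple, Pi.add_apply, ih, List.count_append, List.count_singleton, beq_iff_eq,
      eq_comm (a := w), add_assoc]

/-- The configuration after a sequence of topplings depends only on how often each site
occurs in the sequence. -/
lemma toppleList_fst_apply {N : ℕ} (D : Fin N → ℕ → Fin N → ℤ) (s : List (Fin N))
    (p : (Fin N → ℤ) × (Fin N → ℕ)) (u : Fin N) :
    (toppleList D s p).1 u =
      p.1 u + ∑ w, ∑ k ∈ Finset.range (s.count w), D w (p.2 w + k) u := by
  induction s using List.reverseRecOn with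
  | nil => simp [toppleList]
  | append_singleton s v ih =>
    have hsum (w : Fin N) :
        ∑ k ∈ Finset.range ((s ++ [v]).count w), D w (p.2 w + k) u =
          (∑ k ∈ Finset.range (s.count w), D w (p.2 w + k) u) +
            if v = w then D w (p.2 w + s.count w) u else 0 := by
      by_cases h : v = w
      · subst h
        simp [Finset.sum_range_succ]
      · simp [h]
    rw [toppleList_append_singleton]
    simp only [topple, Pi.add_apply, ih, toppleList_snd_apply, hsum, Finset.sum_add_distrib,
      Finset.sum_ite_eq, Finset.mem_univ, if_true, add_assoc]

/-- If `v` occurs equally often in `t` and `s`, and every other site occurs at most as often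
in `t` as in `s`, then `s` leaves at least as many grains at `v` as `t`. -/
lemma toppleList_fst_le_of_count_le {N : ℕ} {D : Fin N → ℕ → Fin N → ℤ} (hD : IsDeck D)
    {s t : List (Fin N)} (p : (Fin N → ℤ) × (Fin N → ℕ)) {v : Fin N}
    (hle : ∀ w, t.count w ≤ s.count w) (hv : t.count v = s.count v) :
    (toppleList D t p).1 v ≤ (toppleList D s p).1 v := by
  rw [toppleList_fst_apply, toppleList_fst_apply]
  refine add_le_add_right (Finset.sum_le_sum fun w _ => ?_) _
  by_cases hw : v = w
  · subst hw
    rw [hv]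
  · exact Finset.sum_le_sum_of_subset_of_nonneg (Finset.range_mono (hle w))
      fun k _ _ => (hD w _).2.1 v hw

/-- Least action principle: a legal sequence topples each site at most as often as any
sequence whose final configuration is stable. -/
lemma Legal.count_le {N : ℕ} {D : Fin N → ℕ → Fin N → ℤ} (hD : IsDeck D) {M : Fin N → ℤ}
    {p : (Fin N → ℤ) × (Fin N → ℕ)} {s t : List (Fin N)}
    (hs : Stable M (toppleList D s p).1) (ht : Legal D M t p) (w : Fin N) :
    t.count w ≤ s.count w := by
  induction t using List.reverseRecOn generalizing w with
  | nil => simp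
  | append_singleton t v ih =>
    obtain ⟨ht, hv⟩ := ht.of_append_singleton
    have hlt : t.count v < s.count v := by
      refine lt_of_le_of_ne (ih ht v) fun heq => ?_
      exact absurd (hv.trans_le (toppleList_fst_le_of_count_le hD p (ih ht) heq))
        (hs v).not_gt
    by_cases h : v = w
    · subst h
      simpa using hlt
    · simpa [List.count_singleton, h] using ih ht w

/-- If `(η, c)` admits a stabilizing sequence of length `n`, then every legal
sequence for `(η, c)` has length at most `n`. -/
theorem legal_length_le {N : ℕ} (D : Fin N → ℕ → Fin N → ℤ) (hD : IsDeck D)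
    (M : Fin N → ℤ) (η : Fin N → ℤ) (c : Fin N → ℕ)
    (s : List (Fin N)) (hs : Stabilizing D M s (η, c))
    (t : List (Fin N)) (ht : Legal D M t (η, c)) :
    t.length ≤ s.length := by
  exact (List.subperm_ext_iff.2 fun w _ => ht.count_le hD hs.2 w).length_le
end

section
/- Let H ⊆ Fin N be a nonempty set of sites such that no card of a site in H ever sends grains outside of H, i.e. for every ℓ ∈ H and every i ∈ ℕ, ∑_{k ∈ H} (D ℓ i) k ≥ 0. If η is a configuration with ∑_{k ∈ H} η k > ∑_{k ∈ H} M k, then for every counter vector c the configuration with counters (η, c) admits no stabilizing sequence. -/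
/-- If no card of a site in `H` sends grains outside of `H`, then no sequence of
topplings decreases the number of grains on `H`. -/
theorem sum_le_sum_toppleList {N : ℕ} {D : Fin N → ℕ → Fin N → ℤ} (hD : IsDeck D)
    {H : Finset (Fin N)} (hclosed : ∀ ℓ ∈ H, ∀ i : ℕ, 0 ≤ ∑ k ∈ H, D ℓ i k)
    (s : List (Fin N)) (p : (Fin N → ℤ) × (Fin N → ℕ)) :
    ∑ k ∈ H, p.1 k ≤ ∑ k ∈ H, (toppleList D s p).1 k := by
  induction s generalizing p with
  | nil => exact le_rfl
  | cons v s ih =>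
    refine le_trans ?_ (ih (topple D v p))
    have hcard : 0 ≤ ∑ k ∈ H, D v (p.2 v) k := by
      by_cases hv : v ∈ H
      · exact hclosed v hv _
      · exact Finset.sum_nonneg fun k hk =>
          (hD v (p.2 v)).2.1 k (ne_of_mem_of_not_mem hk hv)
    simpa [topple, Finset.sum_add_distrib] using hcard

/-- If `H` is a nonempty set of sites from which no card ever sends grains
outside of `H`, and `η` carries more grains on `H` than the total threshold of
`H`, then `(η, c)` admits no stabilizing sequence, for any counters `c`. -/
theorem no_stabilizing_of_closed_overloaded {N : ℕ}
    (D : Fin N → ℕ → Fin N → ℤ) (hD : IsDeck D) (M : Fin N → ℤ)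
    (H : Finset (Fin N)) (hne : H.Nonempty)
    (hclosed : ∀ ℓ ∈ H, ∀ i : ℕ, 0 ≤ ∑ k ∈ H, D ℓ i k)
    (η : Fin N → ℤ) (hη : ∑ k ∈ H, M k < ∑ k ∈ H, η k) :
    ∀ c : Fin N → ℕ, ¬ ∃ s : List (Fin N), Stabilizing D M s (η, c) := by
  rintro c ⟨s, -, hstable⟩
  exact absurd (hη.trans_le (sum_le_sum_toppleList hD hclosed s (η, c)))
    (not_lt.mpr (Finset.sum_le_sum fun k _ => hstable k))
end

section
/- Legality is monotone under adding sand grains: if the sequence (v_1, …, v_n) is legal for (η, c) and η' : Fin N → ℤ satisfies η' k ≥ η k for all k ∈ Fin N, then (v_1, …, v_n) is legal for (η', c). -/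
/-- Adding grains before a sequence of topplings can only add grains afterwards. -/
theorem toppleList_fst_mono {N : ℕ} (D : Fin N → ℕ → Fin N → ℤ) (s : List (Fin N))
    {η η' : Fin N → ℤ} (c : Fin N → ℕ) (hle : η ≤ η') :
    (toppleList D s (η, c)).1 ≤ (toppleList D s (η', c)).1 := by
  induction s generalizing η η' c with
  | nil => exact hle
  | cons v s ih => exact ih _ (add_le_add_left hle (D v (c v)))

/-- Legality is monotone under adding sand grains. -/
theorem legal_mono {N : ℕ} (D : Fin N → ℕ → Fin N → ℤ) (hD : IsDeck D)
    (M : Fin N → ℤ) (η η' : Fin N → ℤ) (c : Fin N → ℕ)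
    (s : List (Fin N)) (hs : Legal D M s (η, c))
    (hle : ∀ k : Fin N, η k ≤ η' k) :
    Legal D M s (η', c) := by
  intro i
  exact (hs i).trans_le (toppleList_fst_mono D _ c hle _)
end

section
/- Let k, ℓ ∈ Fin N. Suppose (v_1, …, v_n) is a stabilizing sequence for (η + δ^k, c) with result (ξ, d) = (T_{v_n} ∘ ⋯ ∘ T_{v_1})(η + δ^k, c), and (w_1, …, w_m) is a stabilizing sequence for (ξ + δ^ℓ, d). Then the concatenated sequence (v_1, …, v_n, w_1, …, w_m) is a stabilizing sequence for (η + δ^k + δ^ℓ, c). -/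
/-- Toppling a sequence commutes with adding a fixed vector to the configuration. -/
theorem toppleList_add {N : ℕ} (D : Fin N → ℕ → Fin N → ℤ) (s : List (Fin N))
    (η ζ : Fin N → ℤ) (c : Fin N → ℕ) :
    toppleList D s (η + ζ, c) =
      ((toppleList D s (η, c)).1 + ζ, (toppleList D s (η, c)).2) := by
  induction s generalizing η c with
  | nil => rfl
  | cons v s ih =>
    simp only [toppleList, topple, List.foldl_cons] at ih ⊢
    rw [add_right_comm, ih]

theorem toppleList_append {N : ℕ} (D : Fin N → ℕ → Fin N → ℤ) (s t : List (Fin N))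
    (p : (Fin N → ℤ) × (Fin N → ℕ)) :
    toppleList D (s ++ t) p = toppleList D t (toppleList D s p) :=
  List.foldl_append

/-- Legality is preserved by adding grains. -/
theorem Legal.add_of_nonneg {N : ℕ} {D : Fin N → ℕ → Fin N → ℤ} {M : Fin N → ℤ}
    {s : List (Fin N)} {η : Fin N → ℤ} {c : Fin N → ℕ} (h : Legal D M s (η, c))
    {ζ : Fin N → ℤ} (hζ : 0 ≤ ζ) : Legal D M s (η + ζ, c) := by
  intro i
  rw [toppleList_add]
  exact lt_add_of_lt_of_nonneg (h i) (hζ _)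

theorem Legal.append {N : ℕ} {D : Fin N → ℕ → Fin N → ℤ} {M : Fin N → ℤ}
    {s t : List (Fin N)} {p : (Fin N → ℤ) × (Fin N → ℕ)} (hs : Legal D M s p)
    (ht : Legal D M t (toppleList D s p)) : Legal D M (s ++ t) p := by
  rintro ⟨i, hi⟩
  rcases lt_or_ge i s.length with h | h
  · have := hs ⟨i, h⟩
    simpa [List.take_append_of_le_length h.le, List.getElem_append_left h] using this
  · have := ht ⟨i - s.length, by rw [List.length_append] at hi; omega⟩
    simpa [List.take_append, List.take_of_length_le h, toppleList_append,
      List.getElem_append_right h] using this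

/-- Stabilizing after adding a grain at `k`, then stabilizing after adding a
grain at `ℓ`, concatenates to a stabilizing sequence for adding both grains. -/
theorem stabilizing_append {N : ℕ} (D : Fin N → ℕ → Fin N → ℤ) (hD : IsDeck D)
    (M : Fin N → ℤ) (η : Fin N → ℤ) (c : Fin N → ℕ) (k l : Fin N)
    (s : List (Fin N))
    (hs : Stabilizing D M s (η + (fun w => if w = k then 1 else 0), c))
    (ξ : Fin N → ℤ) (d : Fin N → ℕ)
    (hξd : toppleList D s (η + (fun w => if w = k then 1 else 0), c) = (ξ, d))
    (t : List (Fin N))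
    (ht : Stabilizing D M t (ξ + (fun w => if w = l then 1 else 0), d)) :
    Stabilizing D M (s ++ t)
      (η + (fun w => if w = k then 1 else 0) + (fun w => if w = l then 1 else 0), c) := by
  have hsum : toppleList D s
      (η + (fun w => if w = k then 1 else 0) + (fun w => if w = l then 1 else 0), c) =
        (ξ + (fun w => if w = l then 1 else 0), d) := by
    rw [toppleList_add, hξd]
  have hnonneg : (0 : Fin N → ℤ) ≤ fun w => if w = l then 1 else 0 := by
    intro w
    dsimp only [Pi.zero_apply]
    split_ifs <;> simp
  refine ⟨(hs.1.add_of_nonneg hnonneg).append ?_, ?_⟩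
  · rw [hsum]
    exact ht.1
  · rw [toppleList_append, hsum]
    exact ht.2
end

section
/- Grain additions followed by stabilization commute: let k, ℓ ∈ Fin N and let (η, c) be a configuration with counters. Suppose s₁ is a stabilizing sequence for (η + δ^k, c) with result (ξ, d), and s₂ is a stabilizing sequence for (ξ + δ^ℓ, d) with result (ζ, e); suppose likewise t₁ is a stabilizing sequence for (η + δ^ℓ, c) with result (ξ', d'), and t₂ is a stabilizing sequence for (ξ' + δ^k, d') with result (ζ', e'). Then (ζ, e) = (ζ', e'). -/
/-- The total effect on the configuration of the first `u v` cards at every site `v`. -/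
def toppledSum {N : ℕ} (D : Fin N → ℕ → Fin N → ℤ) (u : Fin N → ℕ) : Fin N → ℤ :=
  ∑ v, ∑ i ∈ Finset.range (u v), D v i

/-- The configuration from which all cards used so far have been removed. It is
invariant under topplings. -/
def untoppled {N : ℕ} (D : Fin N → ℕ → Fin N → ℤ)
    (p : (Fin N → ℤ) × (Fin N → ℕ)) : Fin N → ℤ :=
  p.1 - toppledSum D p.2

theorem toppledSum_add_indicator {N : ℕ} (D : Fin N → ℕ → Fin N → ℤ)
    (u : Fin N → ℕ) (v : Fin N) :
    toppledSum D (u + fun w => if w = v then 1 else 0) = toppledSum D u + D v (u v) := by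
  have h : ∀ w, ∑ i ∈ Finset.range (u w + if w = v then 1 else 0), D w i
      = ∑ i ∈ Finset.range (u w), D w i + if w = v then D v (u v) else 0 := by
    intro w
    by_cases hw : w = v
    · subst hw
      simp [Finset.sum_range_succ]
    · simp [hw]
  simp only [toppledSum, Pi.add_apply, h, Finset.sum_add_distrib, Finset.sum_ite_eq',
    Finset.mem_univ, if_true]

theorem untoppled_topple {N : ℕ} (D : Fin N → ℕ → Fin N → ℤ) (v : Fin N)
    (p : (Fin N → ℤ) × (Fin N → ℕ)) : untoppled D (topple D v p) = untoppled D p := by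
  simp only [untoppled, topple, toppledSum_add_indicator]
  abel

theorem untoppled_toppleList {N : ℕ} (D : Fin N → ℕ → Fin N → ℤ) (s : List (Fin N))
    (p : (Fin N → ℤ) × (Fin N → ℕ)) : untoppled D (toppleList D s p) = untoppled D p := by
  induction s generalizing p with
  | nil => rfl
  | cons v s ih => exact (ih (topple D v p)).trans (untoppled_topple D v p)

theorem untoppled_add {N : ℕ} (D : Fin N → ℕ → Fin N → ℤ) (η δ : Fin N → ℤ) (c : Fin N → ℕ) :
    untoppled D (η + δ, c) = untoppled D (η, c) + δ := by
  simp only [untoppled]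
  abel

theorem snd_le_toppleList_snd {N : ℕ} (D : Fin N → ℕ → Fin N → ℤ) (s : List (Fin N))
    (p : (Fin N → ℤ) × (Fin N → ℕ)) : p.2 ≤ (toppleList D s p).2 := by
  induction s generalizing p with
  | nil => exact le_rfl
  | cons v s ih => exact le_trans (fun w => Nat.le_add_right _ _) (ih (topple D v p))

theorem IsDeck.toppledSum_apply_le {N : ℕ} {D : Fin N → ℕ → Fin N → ℤ} (hD : IsDeck D)
    {u u' : Fin N → ℕ} (hu : u ≤ u') {v : Fin N} (hv : u v = u' v) :
    toppledSum D u v ≤ toppledSum D u' v := by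
  simp only [toppledSum, Finset.sum_apply]
  refine Finset.sum_le_sum fun w _ => ?_
  rcases eq_or_ne v w with rfl | hw
  · rw [hv]
  · exact Finset.sum_le_sum_of_subset_of_nonneg (Finset.range_mono (hu w))
      fun i _ _ => (hD w i).2.1 v hw

/-- Least action principle: a legal sequence uses no more cards at any site than any stable
configuration with counters lying above the starting point. -/
theorem Legal.toppleList_snd_le {N : ℕ} {D : Fin N → ℕ → Fin N → ℤ} (hD : IsDeck D)
    {M : Fin N → ℤ} {s : List (Fin N)} {p q : (Fin N → ℤ) × (Fin N → ℕ)}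
    (hs : Legal D M s p) (hq : Stable M q.1) (hpq : untoppled D p ≤ untoppled D q)
    (hc : p.2 ≤ q.2) : (toppleList D s p).2 ≤ q.2 := by
  induction s generalizing p with
  | nil => exact hc
  | cons v s ih =>
    obtain ⟨hv, hs⟩ := legal_cons_iff.1 hs
    have hlt : p.2 v < q.2 v := by
      refine lt_of_le_of_ne (hc v) fun h => ?_
      have hsum := hD.toppledSum_apply_le hc h
      have huntoppled := hpq v
      have hstable := hq v
      simp only [Unstable, untoppled, Pi.sub_apply] at hv huntoppled
      linarith
    refine ih hs ((untoppled_topple D v p).trans_le hpq) fun w => ?_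
    by_cases hw : w = v
    · subst hw
      simpa [topple] using hlt
    · simpa [topple, hw] using hc w

/-- Adding `δ`, toppling legally, adding `ε` and toppling legally uses no more cards than
adding `ε` and `δ` in the opposite order and toppling to a stable configuration. -/
theorem toppleList_snd_le_of_add_comm {N : ℕ} {D : Fin N → ℕ → Fin N → ℤ} (hD : IsDeck D)
    {M η δ ε ξ ζ ξ' ζ' : Fin N → ℤ} {c d e d' e' : Fin N → ℕ} {s₁ s₂ t₁ t₂ : List (Fin N)}
    (hε : 0 ≤ ε) (hs₁ : Legal D M s₁ (η + δ, c)) (hξd : toppleList D s₁ (η + δ, c) = (ξ, d))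
    (hs₂ : Legal D M s₂ (ξ + ε, d)) (hζe : toppleList D s₂ (ξ + ε, d) = (ζ, e))
    (hξd' : toppleList D t₁ (η + ε, c) = (ξ', d'))
    (hζe' : toppleList D t₂ (ξ' + δ, d') = (ζ', e')) (hζ' : Stable M ζ') : e ≤ e' := by
  have hcd' := snd_le_toppleList_snd D t₁ (η + ε, c)
  have hde' := snd_le_toppleList_snd D t₂ (ξ' + δ, d')
  have hξ := untoppled_toppleList D s₁ (η + δ, c)
  have hξ' := untoppled_toppleList D t₁ (η + ε, c)
  have hζ := untoppled_toppleList D t₂ (ξ' + δ, d')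
  rw [hξd, untoppled_add] at hξ
  rw [hξd', untoppled_add] at hξ'
  rw [hζe', untoppled_add, hξ'] at hζ
  rw [hξd'] at hcd'
  rw [hζe'] at hde'
  have hd : d ≤ e' := by
    have h := hs₁.toppleList_snd_le hD (q := (ζ', e')) hζ' ?_ (hcd'.trans hde')
    · rwa [hξd] at h
    · rw [hζ, untoppled_add, add_right_comm]
      exact le_add_of_nonneg_right hε
  have h := hs₂.toppleList_snd_le hD (q := (ζ', e')) hζ' ?_ hd
  · rwa [hζe] at h
  · rw [hζ, untoppled_add, hξ, add_right_comm]

/-- Grain additions followed by stabilization commute: adding a grain at `k`,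
stabilizing, adding a grain at `ℓ` and stabilizing produces the same result as
doing so in the opposite order. -/
theorem add_stabilize_comm {N : ℕ} (D : Fin N → ℕ → Fin N → ℤ) (hD : IsDeck D)
    (M : Fin N → ℤ) (η : Fin N → ℤ) (c : Fin N → ℕ) (k l : Fin N)
    (s₁ : List (Fin N))
    (hs₁ : Stabilizing D M s₁ (η + (fun w => if w = k then 1 else 0), c))
    (ξ : Fin N → ℤ) (d : Fin N → ℕ)
    (hξd : toppleList D s₁ (η + (fun w => if w = k then 1 else 0), c) = (ξ, d))
    (s₂ : List (Fin N))
    (hs₂ : Stabilizing D M s₂ (ξ + (fun w => if w = l then 1 else 0), d))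
    (ζ : Fin N → ℤ) (e : Fin N → ℕ)
    (hζe : toppleList D s₂ (ξ + (fun w => if w = l then 1 else 0), d) = (ζ, e))
    (t₁ : List (Fin N))
    (ht₁ : Stabilizing D M t₁ (η + (fun w => if w = l then 1 else 0), c))
    (ξ' : Fin N → ℤ) (d' : Fin N → ℕ)
    (hξd' : toppleList D t₁ (η + (fun w => if w = l then 1 else 0), c) = (ξ', d'))
    (t₂ : List (Fin N))
    (ht₂ : Stabilizing D M t₂ (ξ' + (fun w => if w = k then 1 else 0), d'))
    (ζ' : Fin N → ℤ) (e' : Fin N → ℕ)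
    (hζe' : toppleList D t₂ (ξ' + (fun w => if w = k then 1 else 0), d') = (ζ', e')) :
    ζ = ζ' ∧ e = e' := by
  have indicator_nonneg : ∀ v : Fin N, (0 : Fin N → ℤ) ≤ fun w => if w = v then 1 else 0 := by
    intro v w
    dsimp only [Pi.zero_apply]
    split_ifs <;> norm_num
  have hζ : Stable M ζ := by simpa only [hζe] using hs₂.2
  have hζ' : Stable M ζ' := by simpa only [hζe'] using ht₂.2
  have he : e = e' := le_antisymm
    (toppleList_snd_le_of_add_comm hD (indicator_nonneg l) hs₁.1 hξd hs₂.1 hζe hξd' hζe' hζ')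
    (toppleList_snd_le_of_add_comm hD (indicator_nonneg k) ht₁.1 hξd' ht₂.1 hζe' hξd hζe hζ)
  refine ⟨?_, he⟩
  have h₁ := untoppled_toppleList D s₁ (η + (fun w => if w = k then 1 else 0), c)
  have h₂ := untoppled_toppleList D s₂ (ξ + (fun w => if w = l then 1 else 0), d)
  have h₁' := untoppled_toppleList D t₁ (η + (fun w => if w = l then 1 else 0), c)
  have h₂' := untoppled_toppleList D t₂ (ξ' + (fun w => if w = k then 1 else 0), d')
  rw [hξd, untoppled_add] at h₁
  rw [hζe, untoppled_add, h₁] at h₂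
  rw [hξd', untoppled_add] at h₁'
  rw [hζe', untoppled_add, h₁', add_right_comm, ← h₂, ← he] at h₂'
  exact (sub_left_injective h₂').symm
end

section
/- Let St be a finite nonempty type and let (P_k)_{k ∈ Fin N} be a family of row-stochastic real matrices indexed by St that pairwise commute: P_k * P_ℓ = P_ℓ * P_k for all k, ℓ. Let μ and μ' be probability distributions on Fin N, and set P = ∑_k μ(k) • P_k and P' = ∑_k μ'(k) • P_k. Suppose π : St → ℝ is a stationary distribution for P, i.e. π(η) ≥ 0 for all η, ∑_η π(η) = 1, and the row vector π satisfies π * P = π. Suppose moreover that the left 1-eigenspace of P is one-dimensional, i.e. the subspace { x : St → ℝ | x * P = x } of row vectors has dimension 1. Then π is also stationary for P': π * P' = π. In particular, the stationary distribution of the stochastic sandpile model does not depend on the distribution governing grain additions. -/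
open Matrix

/-- Row sums equal to `1` make `x ↦ x ᵥ* Q` preserve the total mass. -/
theorem sum_vecMul_of_rowSum_eq_one {St : Type*} [Fintype St] {Q : Matrix St St ℝ}
    (hQ : ∀ i, ∑ j, Q i j = 1) (x : St → ℝ) : ∑ j, (x ᵥ* Q) j = ∑ i, x i := by
  simp only [vecMul, dotProduct]
  rw [Finset.sum_comm]
  simp [← Finset.mul_sum, hQ]

/-- A fixed row vector of total mass `1` spanning the left `1`-eigenspace of `A` is fixed by
every matrix with unit row sums that commutes with `A`. -/
theorem vecMul_eq_self_of_commute {St : Type*} [Fintype St] {A Q : Matrix St St ℝ}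
    (hAQ : Commute A Q) (hQ : ∀ i, ∑ j, Q i j = 1) {x : St → ℝ} (hx1 : ∑ i, x i = 1)
    (hxA : x ᵥ* A = x)
    (hdim : Module.finrank ℝ (LinearMap.ker (A.vecMulLinear - LinearMap.id)) = 1) :
    x ᵥ* Q = x := by
  have hmem : ∀ y : St → ℝ, y ∈ LinearMap.ker (A.vecMulLinear - LinearMap.id) ↔ y ᵥ* A = y := by
    intro y
    simp [LinearMap.mem_ker, sub_eq_zero]
  have hx0 : x ≠ 0 := by
    rintro rfl
    simp at hx1
  have hxQ : (x ᵥ* Q) ᵥ* A = x ᵥ* Q := by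
    rw [vecMul_vecMul, ← hAQ.eq, ← vecMul_vecMul, hxA]
  obtain ⟨c, hc⟩ := exists_smul_eq_of_finrank_eq_one hdim
    (x := ⟨x, (hmem x).2 hxA⟩) (by simpa [Subtype.ext_iff] using hx0) ⟨x ᵥ* Q, (hmem _).2 hxQ⟩
  have hc' : c • x = x ᵥ* Q := congrArg Subtype.val hc
  have hsum := sum_vecMul_of_rowSum_eq_one hQ x
  rw [← hc'] at hsum
  have hc1 : c = 1 := by simpa [← Finset.mul_sum, hx1] using hsum
  rw [← hc', hc1, one_smul]

/-- If the `P_k` are pairwise commuting row-stochastic matrices, `π` is a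
stationary distribution for `P = ∑ μ(k) • P_k` whose left `1`-eigenspace is
one-dimensional, then `π` is also stationary for `P' = ∑ μ'(k) • P_k`:
the stationary distribution does not depend on the grain addition law. -/
theorem stationary_independent_of_addition_law {St : Type*} [Fintype St] [Nonempty St]
    {N : ℕ} (P : Fin N → Matrix St St ℝ)
    (hnonneg : ∀ k i j, 0 ≤ P k i j)
    (hrowsum : ∀ k i, ∑ j, P k i j = 1)
    (hcomm : ∀ k l, P k * P l = P l * P k)
    (μ μ' : Fin N → ℝ)
    (hμ0 : ∀ k, 0 ≤ μ k) (hμ1 : ∑ k, μ k = 1)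
    (hμ'0 : ∀ k, 0 ≤ μ' k) (hμ'1 : ∑ k, μ' k = 1)
    (π : St → ℝ)
    (hπ0 : ∀ η, 0 ≤ π η) (hπ1 : ∑ η, π η = 1)
    (hstat : π ᵥ* (∑ k, μ k • P k) = π)
    (hdim : Module.finrank ℝ
      (LinearMap.ker ((∑ k, μ k • P k).vecMulLinear - LinearMap.id)) = 1) :
    π ᵥ* (∑ k, μ' k • P k) = π := by
  refine vecMul_eq_self_of_commute ?_ ?_ hπ1 hstat hdim
  · exact Commute.sum_left _ _ _ fun k _ => Commute.sum_right _ _ _ fun l _ =>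
      ((show Commute (P k) (P l) from hcomm k l).smul_left _).smul_right _
  · intro i
    simp only [Matrix.sum_apply, Matrix.smul_apply, smul_eq_mul]
    rw [Finset.sum_comm]
    simp [← Finset.mul_sum, hrowsum, hμ'1]
end
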